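/- Let 𝔦, 𝔧 ∈ ℂ satisfy 𝔦² = −1 and 𝔧² = −1/3. For all (y₂,y₃) ∈ ℂ², the value of f at (1, −𝔧, y₂, y₃) equals (y₂² + y₃²)·(1, 0, 0, −𝔧, −1/3) ∈ ℂ⁵. In particular, the restriction of f to the fiber {(1:−𝔧)}×ℙ¹ of the first projection is constant where defined: this fiber, which contains two base points of f, is contracted by f to a single point of ℙ⁴(ℂ). -/

import Mathlib

/-- The components of the birational map `f : ℙ¹×ℙ¹ ⇢ ℙ⁴` whose image projects
to a torus of revolution. -/
noncomputable def tF (y : Fin 4 → ℂ) : Fin 5 → ℂ :=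
  ![y 0 ^ 2 * y 2 ^ 2 - 3 * (y 1 ^ 2 * y 3 ^ 2),
    y 0 ^ 2 * y 2 * y 3 + 3 * (y 1 ^ 2 * y 2 * y 3),
    y 0 ^ 2 * y 3 ^ 2 + 3 * (y 1 ^ 2 * y 3 ^ 2),
    y 0 * y 1 * y 2 ^ 2 + y 0 * y 1 * y 3 ^ 2,
    y 1 ^ 2 * y 2 ^ 2 + y 1 ^ 2 * y 3 ^ 2]

/-- On the fiber `y₁ = -𝔧 y₀` of the first projection, `tF` is a scalar multiple of a constant
vector. -/
theorem tF_fiber (𝔧 : ℂ) (h𝔧 : 𝔧 ^ 2 = -(1 / 3)) (y₂ y₃ : ℂ) :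
    tF ![1, -𝔧, y₂, y₃] = (y₂ ^ 2 + y₃ ^ 2) • ![1, 0, 0, -𝔧, -(1 / 3)] := by
  ext k
  fin_cases k <;> simp [tF, h𝔧] <;> ring

theorem stmt16 (𝔦 𝔧 : ℂ) (h𝔦 : 𝔦 ^ 2 = -1) (h𝔧 : 𝔧 ^ 2 = -(1 / 3)) :
    (∀ y₂ y₃ : ℂ,
      tF ![1, -𝔧, y₂, y₃] = (y₂ ^ 2 + y₃ ^ 2) • ![1, 0, 0, -𝔧, -(1 / 3)]) ∧
    (∀ (y₂ y₃ y₂' y₃' : ℂ)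
      (h : tF ![1, -𝔧, y₂, y₃] ≠ 0) (h' : tF ![1, -𝔧, y₂', y₃'] ≠ 0),
      Projectivization.mk ℂ (tF ![1, -𝔧, y₂, y₃]) h =
        Projectivization.mk ℂ (tF ![1, -𝔧, y₂', y₃']) h') := by
  refine ⟨tF_fiber 𝔧 h𝔧, fun y₂ y₃ y₂' y₃' h h' => ?_⟩
  rw [Projectivization.mk_eq_mk_iff']
  have hne : y₂' ^ 2 + y₃' ^ 2 ≠ 0 := fun h0 => h' (by rw [tF_fiber 𝔧 h𝔧, h0, zero_smul])
  refine ⟨(y₂ ^ 2 + y₃ ^ 2) / (y₂' ^ 2 + y₃' ^ 2), ?_⟩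
  rw [tF_fiber 𝔧 h𝔧, tF_fiber 𝔧 h𝔧, smul_smul, div_mul_cancel₀ _ hne]
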